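/- Let T ⊆ [n-1] have r elements and write A^T_n(x) = Σ_{i=0}^r h_i(T) x^i. Then h_0(T) ≤ h_1(T) ≤ ... ≤ h_{⌊r/2⌋}(T). -/

import Mathlib

open Polynomial

open scoped Classical

noncomputable section

/-- The descent set of a permutation `w` of `Fin n`, recorded as a subset of
`{1, ..., n-1}` (1-based positions, as in the paper: `i ∈ Des(w)` iff `w(i) > w(i+1)`). -/
def descSet {n : ℕ} (w : Equiv.Perm (Fin n)) : Finset ℕ :=
  (Finset.univ.filter (fun i : Fin (n - 1) =>
      w ⟨i.val + 1, by have := i.isLt; omega⟩ < w ⟨i.val, by have := i.isLt; omega⟩)).image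
    (fun i => i.val + 1)

/-- `A^T_n(x) = Σ_{w ∈ S_n, Des(w) ⊆ T} x^{des(w)}` (note `Des(w) ⊆ {1,...,n-1}`
automatically, so this also realizes the convention `A^T_n := A^{T ∩ [n-1]}_n`). -/
def Apoly (n : ℕ) (T : Finset ℕ) : Polynomial ℝ :=
  ∑ w ∈ Finset.univ.filter (fun w : Equiv.Perm (Fin n) => descSet w ⊆ T),
    X ^ (descSet w).card

/-- `p^T_{n,k}(x) = Σ x^{des(w)}` over permutations `w ∈ S_{n+1}` with `w(1) = k+1`
(0-based: `w 0 = k`) and `Des(w) ⊆ T`. -/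
def ppoly (n k : ℕ) (T : Finset ℕ) : Polynomial ℝ :=
  ∑ w ∈ Finset.univ.filter (fun w : Equiv.Perm (Fin (n + 1)) =>
      (w 0 : ℕ) = k ∧ descSet w ⊆ T),
    X ^ (descSet w).card

/-- A real polynomial has only real roots (or is identically zero). -/
def RealRooted (p : Polynomial ℝ) : Prop :=
  p = 0 ∨ ∀ z : ℂ, Polynomial.aeval z p = 0 → z.im = 0

/-- The list of real roots of `p`, with multiplicity, in decreasing order. -/
def rootsDesc (p : Polynomial ℝ) : List ℝ :=
  (p.roots.sort (· ≤ ·)).reverse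

/-- `Interlaces p q` means `p ⪯ q`: both are real-rooted and, listing the roots of `p`
as `α_1 ≥ α_2 ≥ ⋯` and those of `q` as `β_1 ≥ β_2 ≥ ⋯`, one has
`⋯ ≤ α_2 ≤ β_2 ≤ α_1 ≤ β_1`; by convention the zero polynomial interlaces and is
interlaced by every real-rooted polynomial. -/
def Interlaces (p q : Polynomial ℝ) : Prop :=
  (p = 0 ∧ RealRooted q) ∨ (q = 0 ∧ RealRooted p) ∨
  (RealRooted p ∧ RealRooted q ∧
    Multiset.card q.roots ≤ Multiset.card p.roots + 1 ∧
    Multiset.card p.roots ≤ Multiset.card q.roots ∧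
    (∀ (i : ℕ) (hp : i < (rootsDesc p).length) (hq : i < (rootsDesc q).length),
      (rootsDesc p).get ⟨i, hp⟩ ≤ (rootsDesc q).get ⟨i, hq⟩) ∧
    (∀ (i : ℕ) (hq : i + 1 < (rootsDesc q).length) (hp : i < (rootsDesc p).length),
      (rootsDesc q).get ⟨i + 1, hq⟩ ≤ (rootsDesc p).get ⟨i, hp⟩))

/-- Polynomials with nonnegative coefficients such that `f_i ≤ f_j` for `i ≤ j`, `i + j < s`. -/
def WW (s : ℕ) (f : Polynomial ℝ) : Prop :=
  (∀ i, 0 ≤ f.coeff i) ∧ ∀ i j, i ≤ j → i + j + 1 ≤ s → f.coeff i ≤ f.coeff j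

lemma WW.mono {s t : ℕ} {f : Polynomial ℝ} (h : WW s f) (hts : t ≤ s) : WW t f :=
  ⟨h.1, fun i j hij hs => h.2 i j hij (by omega)⟩

lemma WW.add {s : ℕ} {f g : Polynomial ℝ} (hf : WW s f) (hg : WW s g) : WW s (f + g) := by
  refine ⟨fun i => ?_, fun i j hij hs => ?_⟩
  · rw [coeff_add]; exact add_nonneg (hf.1 i) (hg.1 i)
  · rw [coeff_add, coeff_add]; exact add_le_add (hf.2 i j hij hs) (hg.2 i j hij hs)

lemma WW.zero (s : ℕ) : WW s 0 := by
  refine ⟨fun i => ?_, fun i j hij hs => ?_⟩ <;> simp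

lemma WW.sum {ι : Type*} {s : ℕ} (A : Finset ι) (f : ι → Polynomial ℝ)
    (h : ∀ a ∈ A, WW s (f a)) : WW s (∑ a ∈ A, f a) :=
  Finset.sum_induction f (WW s) (fun _ _ ha hb => ha.add hb) (WW.zero s) h

lemma WW.half {s : ℕ} {f : Polynomial ℝ} (hf : WW s (f + f)) : WW s f := by
  refine ⟨fun i => ?_, fun i j hij hs => ?_⟩
  · have := hf.1 i
    rw [coeff_add] at this; linarith
  · have := hf.2 i j hij hs
    rw [coeff_add, coeff_add] at this; linarith

lemma WW.X_mul {s : ℕ} {f : Polynomial ℝ} (hf : WW s f) : WW (s + 2) (X * f) := by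
  have h0 : ∀ i, 0 ≤ (X * f).coeff i := by
    intro i
    cases i with
    | zero => simp
    | succ i => rw [coeff_X_mul]; exact hf.1 i
  refine ⟨h0, fun i j hij hs => ?_⟩
  cases i with
  | zero => rw [coeff_X_mul_zero]; exact h0 j
  | succ i =>
    cases j with
    | zero => omega
    | succ j => rw [coeff_X_mul, coeff_X_mul]; exact hf.2 i j (by omega) (by omega)

lemma WW.one_add_X_mul {s : ℕ} {f : Polynomial ℝ} (hf : WW s f) :
    WW (s + 1) (f + X * f) := by
  refine ⟨fun i => ?_, fun i j hij hs => ?_⟩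
  · rw [coeff_add]; exact add_nonneg (hf.1 i) (hf.X_mul.1 i)
  · rcases Nat.eq_or_lt_of_le hij with rfl | hlt
    · exact le_rfl
    · cases j with
      | zero => omega
      | succ j =>
        rw [coeff_add, coeff_add, coeff_X_mul]
        have h1 : f.coeff i ≤ f.coeff j := hf.2 i j (by omega) (by omega)
        have h2 : (X * f).coeff i ≤ f.coeff (j + 1) := by
          cases i with
          | zero => rw [coeff_X_mul_zero]; exact hf.1 _
          | succ i => rw [coeff_X_mul]; exact hf.2 i (j + 1) (by omega) (by omega)
        linarith

/-- The invariant. -/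
structure GoodSeq (n r : ℕ) (q : ℕ → Polynomial ℝ) : Prop where
  g1 : ∀ j, j ≤ n → WW r (q j)
  g3 : ∀ i j, i + j ≤ n → WW (r + 1) (q i + q j)
  g4 : ∀ i j, j ≤ i → i + j ≤ n → WW (r + 2) (q j + X * q i)

/-- Interval sums. -/
def ISum (q : ℕ → Polynomial ℝ) (a b : ℕ) : Polynomial ℝ := ∑ x ∈ Finset.Ico a b, q x

lemma ISum_add (q : ℕ → Polynomial ℝ) {a b c : ℕ} (h1 : a ≤ b) (h2 : b ≤ c) :
    ISum q a c = ISum q a b + ISum q b c :=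
  (Finset.sum_Ico_consecutive q h1 h2).symm

lemma GoodSeq.L1 {n r : ℕ} {q : ℕ → Polynomial ℝ} (h : GoodSeq n r q) (a b : ℕ)
    (hb : b ≤ n + 1) : WW r (ISum q a b) :=
  WW.sum _ _ fun x hx => h.g1 x (by have := Finset.mem_Ico.1 hx; omega)

lemma GoodSeq.L3 {n r : ℕ} {q : ℕ → Polynomial ℝ} (h : GoodSeq n r q) (a b : ℕ)
    (hb : a + b ≤ n + 1) : WW (r + 1) (ISum q a b) := by
  apply WW.half
  have h2 : ISum q a b = ∑ x ∈ Finset.Ico a b, q (a + b - 1 - x) := by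
    unfold ISum
    refine Finset.sum_nbij' (fun x => a + b - 1 - x) (fun x => a + b - 1 - x) ?_ ?_ ?_ ?_ ?_
    · intro x hx; simp only [Finset.mem_Ico] at hx ⊢; omega
    · intro x hx; simp only [Finset.mem_Ico] at hx ⊢; omega
    · intro x hx; simp only [Finset.mem_Ico] at hx ⊢; omega
    · intro x hx; simp only [Finset.mem_Ico] at hx ⊢; omega
    · intro x hx; simp only [Finset.mem_Ico] at hx
      congr 1; omega
  nth_rewrite 2 [h2]
  unfold ISum
  rw [← Finset.sum_add_distrib]
  refine WW.sum _ _ fun x hx => h.g3 _ _ ?_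
  have := Finset.mem_Ico.1 hx; omega

lemma GoodSeq.L4 {n r : ℕ} {q : ℕ → Polynomial ℝ} (h : GoodSeq n r q) (j : ℕ)
    (hj : 2 * j ≤ n + 1) : WW (r + 2) (ISum q 0 j + X * ISum q (n + 1 - j) (n + 1)) := by
  have h2 : ISum q (n + 1 - j) (n + 1) = ∑ x ∈ Finset.Ico 0 j, q (n - x) := by
    unfold ISum
    refine Finset.sum_nbij' (fun x => n - x) (fun x => n - x) ?_ ?_ ?_ ?_ ?_
    · intro x hx; simp only [Finset.mem_Ico] at hx ⊢; omega
    · intro x hx; simp only [Finset.mem_Ico] at hx ⊢; omega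
    · intro x hx; simp only [Finset.mem_Ico] at hx ⊢; omega
    · intro x hx; simp only [Finset.mem_Ico] at hx ⊢; omega
    · intro x hx; simp only [Finset.mem_Ico] at hx
      congr 1; omega
  rw [h2]
  unfold ISum
  rw [Finset.mul_sum, ← Finset.sum_add_distrib]
  refine WW.sum _ _ fun x hx => h.g4 _ _ ?_ ?_
  · have := Finset.mem_Ico.1 hx; omega
  · have := Finset.mem_Ico.1 hx; omega

lemma GoodSeq.congr {n r : ℕ} {q q' : ℕ → Polynomial ℝ} (h : GoodSeq n r q)
    (hq : ∀ k, k ≤ n → q' k = q k) : GoodSeq n r q' := by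
  refine ⟨fun j hj => ?_, fun i j hij => ?_, fun i j hji hij => ?_⟩
  · rw [hq j hj]; exact h.g1 j hj
  · rw [hq i (by omega), hq j (by omega)]; exact h.g3 i j hij
  · rw [hq i (by omega), hq j (by omega)]; exact h.g4 i j hji hij

lemma GoodSeq.stepN {n r : ℕ} {q : ℕ → Polynomial ℝ} (h : GoodSeq n r q) :
    GoodSeq (n + 1) r (fun k => ISum q 0 k) := by
  refine ⟨fun j hj => ?_, fun i j hij => ?_, fun i j hji hij => ?_⟩
  · exact h.L1 _ _ hj
  · exact (h.L3 0 i (by omega)).add (h.L3 0 j (by omega))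
  · have e : ISum q 0 j + X * ISum q 0 i
        = (ISum q 0 j + X * ISum q 0 j) + X * ISum q j i := by
      rw [ISum_add q (Nat.zero_le j) hji]; ring
    show WW _ (ISum q 0 j + X * ISum q 0 i)
    rw [e]
    exact (h.L3 0 j (by omega)).one_add_X_mul.add (h.L1 j i (by omega)).X_mul

lemma GoodSeq.stepD {n r : ℕ} {q : ℕ → Polynomial ℝ} (h : GoodSeq n r q) :
    GoodSeq (n + 1) (r + 1) (fun k => ISum q 0 k + X * ISum q k (n + 1)) := by
  have key : ∀ k, 2 * k ≤ n + 1 → WW (r + 2) (ISum q 0 k + X * ISum q k (n + 1)) := by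
    intro k hk
    have e : ISum q 0 k + X * ISum q k (n + 1)
        = (ISum q 0 k + X * ISum q (n + 1 - k) (n + 1)) + X * ISum q k (n + 1 - k) := by
      rw [ISum_add q (show k ≤ n + 1 - k by omega) (show n + 1 - k ≤ n + 1 by omega)]; ring
    rw [e]
    exact (h.L4 k hk).add (h.L1 _ _ (by omega)).X_mul
  have g3' : ∀ i j, j ≤ i → i + j ≤ n + 1 →
      WW (r + 2) ((ISum q 0 i + X * ISum q i (n + 1)) + (ISum q 0 j + X * ISum q j (n + 1))) := by
    intro i j hji hij
    by_cases hi : 2 * i ≤ n + 1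
    · exact (key i hi).add (key j (by omega))
    · obtain ⟨c, hc⟩ : ∃ c, n + 1 = i + c := ⟨n + 1 - i, by omega⟩
      have l4a := h.L4 c (by omega)
      have l4b := h.L4 j (by omega)
      have e1 : n + 1 - c = i := by omega
      rw [e1] at l4a
      have e : (ISum q 0 i + X * ISum q i (n + 1)) + (ISum q 0 j + X * ISum q j (n + 1))
          = (ISum q 0 c + X * ISum q i (n + 1)) + (ISum q c i + X * ISum q c i)
            + (ISum q 0 j + X * ISum q (n + 1 - j) (n + 1))
            + X * ISum q j c + X * ISum q i (n + 1 - j) := by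
        rw [ISum_add q (show 0 ≤ c by omega) (show c ≤ i by omega),
          ISum_add q (show j ≤ c by omega) (show c ≤ n + 1 by omega),
          ISum_add q (show c ≤ i by omega) (show i ≤ n + 1 by omega),
          ISum_add q (show i ≤ n + 1 - j by omega) (show n + 1 - j ≤ n + 1 by omega)]
        ring
      rw [e]
      exact (((l4a.add (h.L3 c i (by omega)).one_add_X_mul).add l4b).add
        (h.L1 _ _ (by omega)).X_mul).add (h.L1 _ _ (by omega)).X_mul
  refine ⟨fun j hj => ?_, fun i j hij => ?_, fun i j hji hij => ?_⟩
  · exact (h.L3 0 j (by omega)).add ((h.L1 j (n + 1) le_rfl).X_mul.mono (by omega))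
  · rcases le_total j i with hji | hji
    · exact g3' i j hji hij
    · show WW _ ((ISum q 0 i + X * ISum q i (n + 1)) + (ISum q 0 j + X * ISum q j (n + 1)))
      rw [add_comm (ISum q 0 i + X * ISum q i (n + 1))]
      exact g3' j i hji (by omega)
  · show WW _ ((ISum q 0 j + X * ISum q j (n + 1)) + X * (ISum q 0 i + X * ISum q i (n + 1)))
    have e : (ISum q 0 j + X * ISum q j (n + 1)) + X * (ISum q 0 i + X * ISum q i (n + 1))
        = ((ISum q 0 j + X * ISum q (n + 1 - j) (n + 1))
            + X * (ISum q 0 j + X * ISum q (n + 1 - j) (n + 1)))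
          + X * ISum q j (n + 1 - j) + X * ISum q j i + X * (X * ISum q i (n + 1 - j)) := by
      rw [ISum_add q (show 0 ≤ j by omega) hji,
        ISum_add q (show j ≤ n + 1 - j by omega) (show n + 1 - j ≤ n + 1 by omega),
        ISum_add q (show i ≤ n + 1 - j by omega) (show n + 1 - j ≤ n + 1 by omega)]
      ring
    rw [e]
    exact (((h.L4 j (by omega)).one_add_X_mul.add (h.L3 _ _ (by omega)).X_mul).add
      (h.L3 _ _ (by omega)).X_mul).add ((h.L1 _ _ (by omega)).X_mul.X_mul.mono (by omega))

lemma GoodSeq.base {q : ℕ → Polynomial ℝ} (h0 : q 0 = 1) : GoodSeq 0 0 q := by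
  refine ⟨fun j hj => ?_, fun i j hij => ?_, fun i j hji hij => ?_⟩
  · obtain rfl : j = 0 := by omega
    rw [h0]
    refine ⟨fun i => ?_, fun i j hij hs => by omega⟩
    rw [coeff_one]; split_ifs <;> norm_num
  · obtain rfl : j = 0 := by omega
    obtain rfl : i = 0 := by omega
    rw [h0]
    refine ⟨fun i => ?_, fun i j hij hs => ?_⟩
    · rw [coeff_add, coeff_one]; split_ifs <;> norm_num
    · obtain rfl : j = 0 := by omega
      obtain rfl : i = 0 := by omega
      exact le_rfl
  · obtain rfl : j = 0 := by omega
    obtain rfl : i = 0 := by omega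
    rw [h0]
    have : WW 1 (1 : Polynomial ℝ) := by
      refine ⟨fun i => ?_, fun i j hij hs => ?_⟩
      · rw [coeff_one]; split_ifs <;> norm_num
      · obtain rfl : j = 0 := by omega
        obtain rfl : i = 0 := by omega
        exact le_rfl
    exact this.one_add_X_mul

/-- Append a last letter `k` to `v`, standardizing. -/
def appendLast {n : ℕ} (k : Fin (n + 2)) (v : Equiv.Perm (Fin (n + 1))) :
    Equiv.Perm (Fin (n + 2)) :=
  ((finSuccEquiv' (Fin.last (n + 1))).trans (Equiv.optionCongr v)).trans (finSuccEquiv' k).symm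

lemma appendLast_last {n : ℕ} (k : Fin (n + 2)) (v : Equiv.Perm (Fin (n + 1))) :
    appendLast k v (Fin.last (n + 1)) = k := by
  simp [appendLast]

lemma appendLast_castSucc {n : ℕ} (k : Fin (n + 2)) (v : Equiv.Perm (Fin (n + 1)))
    (i : Fin (n + 1)) : appendLast k v i.castSucc = k.succAbove (v i) := by
  have : (finSuccEquiv' (Fin.last (n + 1))) i.castSucc = some i := by
    rw [← Fin.succAbove_last_apply, finSuccEquiv'_succAbove]
  simp [appendLast, this]

lemma appendLast_bij (n : ℕ) : Function.Bijective
    (fun p : Fin (n + 2) × Equiv.Perm (Fin (n + 1)) => appendLast p.1 p.2) := by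
  rw [Fintype.bijective_iff_injective_and_card]
  constructor
  · rintro ⟨k, v⟩ ⟨k', v'⟩ h
    simp only at h
    have hk : k = k' := by
      rw [← appendLast_last k v, h, appendLast_last]
    subst hk
    have hv : v = v' := by
      ext1 i
      have := congrArg (fun w => w i.castSucc) h
      simp only [appendLast_castSucc] at this
      exact Fin.succAbove_right_injective this
    rw [hv]
  · simp [Fintype.card_perm, Nat.factorial_succ]

lemma mem_descSet {n : ℕ} (w : Equiv.Perm (Fin n)) (m : ℕ) :
    m ∈ descSet w ↔ ∃ (i : ℕ) (hi : i + 1 < n), m = i + 1 ∧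
      w ⟨i + 1, hi⟩ < w ⟨i, by omega⟩ := by
  unfold descSet
  simp only [Finset.mem_image, Finset.mem_filter, Finset.mem_univ, true_and]
  constructor
  · rintro ⟨i, h, rfl⟩
    exact ⟨i.val, by have := i.isLt; omega, rfl, h⟩
  · rintro ⟨i, hi, rfl, h⟩
    exact ⟨⟨i, by omega⟩, h, rfl⟩

lemma descSet_append {n : ℕ} (k : Fin (n + 2)) (v : Equiv.Perm (Fin (n + 1))) :
    descSet (appendLast k v) =
      if (v (Fin.last n) : ℕ) < k then descSet v else insert (n + 1) (descSet v) := by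
  have key : ∀ m, m ∈ descSet (appendLast k v) ↔
      (m ∈ descSet v ∨ (m = n + 1 ∧ ¬ (v (Fin.last n) : ℕ) < k)) := by
    intro m
    rw [mem_descSet, mem_descSet]
    have hl : appendLast k v ⟨n + 1, by omega⟩ < appendLast k v ⟨n, by omega⟩ ↔
        ¬ (v (Fin.last n) : ℕ) < k := by
      have e1 : (⟨n + 1, by omega⟩ : Fin (n + 2)) = Fin.last (n + 1) := rfl
      have e2 : (⟨n, by omega⟩ : Fin (n + 2)) = (Fin.last n).castSucc := rfl
      rw [e1, e2, appendLast_last, appendLast_castSucc, Fin.lt_succAbove_iff_le_castSucc,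
        Fin.le_def, Fin.val_castSucc, not_lt]
    have hs : ∀ i (hi : i + 1 < n + 1),
        (appendLast k v ⟨i + 1, by omega⟩ < appendLast k v ⟨i, by omega⟩ ↔
          v ⟨i + 1, hi⟩ < v ⟨i, by omega⟩) := by
      intro i hi
      have e1 : (⟨i + 1, by omega⟩ : Fin (n + 2)) = (⟨i + 1, hi⟩ : Fin (n + 1)).castSucc := rfl
      have e2 : (⟨i, by omega⟩ : Fin (n + 2)) = (⟨i, by omega⟩ : Fin (n + 1)).castSucc := rfl
      rw [e1, e2, appendLast_castSucc, appendLast_castSucc, Fin.succAbove_lt_succAbove_iff]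
    constructor
    · rintro ⟨i, hi, rfl, h⟩
      by_cases hin : i = n
      · subst hin
        exact Or.inr ⟨rfl, hl.1 h⟩
      · exact Or.inl ⟨i, by omega, rfl, (hs i (by omega)).1 h⟩
    · rintro (⟨i, hi, rfl, h⟩ | ⟨rfl, h⟩)
      · exact ⟨i, by omega, rfl, (hs i hi).2 h⟩
      · exact ⟨n, by omega, rfl, hl.2 h⟩
  ext m
  rw [key]
  split_ifs with h
  · simp [h]
  · simp [h, or_comm]

lemma not_mem_descSet {n : ℕ} (v : Equiv.Perm (Fin (n + 1))) : n + 1 ∉ descSet v := by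
  rw [mem_descSet]
  rintro ⟨i, hi, h, -⟩
  omega

/-- The weight of a permutation. -/
def wt (T : Finset ℕ) {n : ℕ} (w : Equiv.Perm (Fin n)) : Polynomial ℝ :=
  if descSet w ⊆ T then X ^ (descSet w).card else 0

/-- Transfer coefficient. -/
def tc (T : Finset ℕ) (n k j : ℕ) : Polynomial ℝ :=
  if j < k then 1 else if n + 1 ∈ T then X else 0

lemma wt_append (T : Finset ℕ) {n : ℕ} (k : Fin (n + 2)) (v : Equiv.Perm (Fin (n + 1))) :
    wt T (appendLast k v) = tc T n k (v (Fin.last n)) * wt T v := by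
  unfold wt tc
  rw [descSet_append]
  by_cases h : (v (Fin.last n) : ℕ) < k
  · simp [h]
  · by_cases hT : n + 1 ∈ T
    · by_cases hs : descSet v ⊆ T
      · simp [h, hT, hs, Finset.insert_subset_iff, not_mem_descSet, pow_succ']
      · simp [h, hs, Finset.insert_subset_iff]
    · simp [h, hT, Finset.insert_subset_iff]

/-- Refinement by the last letter. -/
def Qp (T : Finset ℕ) (n k : ℕ) : Polynomial ℝ :=
  ∑ w : Equiv.Perm (Fin (n + 1)), if (w (Fin.last n) : ℕ) = k then wt T w else 0

lemma sum_Qp (T : Finset ℕ) (n : ℕ) (c : ℕ → Polynomial ℝ) :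
    ∑ j ∈ Finset.range (n + 1), c j * Qp T n j =
      ∑ w : Equiv.Perm (Fin (n + 1)), c (w (Fin.last n)) * wt T w := by
  unfold Qp
  simp_rw [Finset.mul_sum]
  rw [Finset.sum_comm]
  refine Finset.sum_congr rfl fun w _ => ?_
  simp only [mul_ite, mul_zero]
  rw [Finset.sum_ite_eq, if_pos]
  exact Finset.mem_range.2 (w (Fin.last n)).isLt

lemma Qp_succ (T : Finset ℕ) (n k : ℕ) (hk : k ≤ n + 1) :
    Qp T (n + 1) k = ∑ j ∈ Finset.range (n + 1), tc T n k j * Qp T n j := by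
  rw [sum_Qp]
  unfold Qp
  rw [← (appendLast_bij n).sum_comp, Fintype.sum_prod_type,
    Finset.sum_eq_single (⟨k, by omega⟩ : Fin (n + 2))]
  · refine Finset.sum_congr rfl fun v _ => ?_
    rw [appendLast_last, if_pos rfl, wt_append]
  · intro b _ hb
    refine Finset.sum_eq_zero fun v _ => ?_
    rw [appendLast_last, if_neg]
    intro h
    exact hb (Fin.ext h)
  · intro h
    exact absurd (Finset.mem_univ _) h

lemma Qp_succ' (T : Finset ℕ) (n k : ℕ) (hk : k ≤ n + 1) :
    Qp T (n + 1) k = ISum (Qp T n) 0 k +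
      (if n + 1 ∈ T then X else 0) * ISum (Qp T n) k (n + 1) := by
  rw [Qp_succ T n k hk, Finset.range_eq_Ico,
    ← Finset.sum_Ico_consecutive _ (Nat.zero_le k) hk]
  unfold ISum
  rw [Finset.mul_sum]
  congr 1
  · refine Finset.sum_congr rfl fun j hj => ?_
    rw [tc, if_pos (Finset.mem_Ico.1 hj).2, one_mul]
  · refine Finset.sum_congr rfl fun j hj => ?_
    rw [tc, if_neg (not_lt.2 (Finset.mem_Ico.1 hj).1)]

lemma Qp_good (T : Finset ℕ) (n : ℕ) :
    GoodSeq n (T ∩ Finset.Icc 1 n).card (Qp T n) := by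
  induction n with
  | zero =>
    have : T ∩ Finset.Icc 1 0 = ∅ := by simp
    rw [this, Finset.card_empty]
    apply GoodSeq.base
    have hd : ∀ w : Equiv.Perm (Fin (0 + 1)), descSet w = ∅ := by
      intro w
      ext m
      rw [mem_descSet]
      constructor
      · rintro ⟨i, hi, -⟩; omega
      · intro h; simp at h
    unfold Qp wt
    simp [hd]
  | succ n ih =>
    have hI : Finset.Icc 1 (n + 1) = insert (n + 1) (Finset.Icc 1 n) := by
      ext m; simp only [Finset.mem_Icc, Finset.mem_insert]; omega
    by_cases hT : n + 1 ∈ T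
    · have : (T ∩ Finset.Icc 1 (n + 1)).card = (T ∩ Finset.Icc 1 n).card + 1 := by
        rw [hI, Finset.inter_insert_of_mem hT, Finset.card_insert_of_notMem]
        simp
      rw [this]
      refine ih.stepD.congr fun k hk => ?_
      rw [Qp_succ' T n k hk, if_pos hT]
    · have : T ∩ Finset.Icc 1 (n + 1) = T ∩ Finset.Icc 1 n := by
        rw [hI, Finset.inter_insert_of_notMem hT]
      rw [this]
      refine ih.stepN.congr fun k hk => ?_
      rw [Qp_succ' T n k hk, if_neg hT, zero_mul, add_zero]

lemma Apoly_eq (T : Finset ℕ) (n : ℕ) : Apoly (n + 1) T = ISum (Qp T n) 0 (n + 1) := by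
  have := sum_Qp T n (fun _ => 1)
  simp only [one_mul] at this
  unfold ISum
  rw [← Finset.range_eq_Ico, this]
  unfold Apoly wt
  rw [Finset.sum_filter]

/-- Let `T ⊆ [n-1]` have `r` elements and write
`A^T_n(x) = Σ_{i=0}^r h_i(T) x^i`.  Then `h_0(T) ≤ h_1(T) ≤ ⋯ ≤ h_{⌊r/2⌋}(T)`. -/
theorem stmt7 (n : ℕ) (hn : 0 < n) (T : Finset ℕ) (hT : T ⊆ Finset.Icc 1 (n - 1))
    (r : ℕ) (hr : T.card = r) :
    ∀ i : ℕ, i + 1 ≤ r / 2 → (Apoly n T).coeff i ≤ (Apoly n T).coeff (i + 1) := by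
  intro i hi
  obtain ⟨m, rfl⟩ : ∃ m, n = m + 1 := ⟨n - 1, by omega⟩
  have hTI : T ∩ Finset.Icc 1 m = T := Finset.inter_eq_left.2 (by simpa using hT)
  have hg := Qp_good T m
  rw [hTI, hr] at hg
  rw [Apoly_eq]
  exact (hg.L3 0 (m + 1) (by omega)).2 i (i + 1) (by omega) (by omega)
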